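/- Let W be a symmetric and singular discrete memoryless channel with no all-zero columns, let q(y) = Σ_x |X|^{−1} W(y|x) and α_y = Σ_{x: W(y|x)>0} |X|^{−1}, and fix any x_o ∈ X. Then: (a) for every x ∈ X, Σ_y W(y|x) ln(W(y|x)/q(y)) = C(W), the variance Var_{W(·|x)}[ln(W(Y|x)/q(Y))] does not depend on x and equals V_ε(W) for every ε ∈ (0,1) (call this common value V(W)), and the third absolute central moment m₃(x) = E_{W(·|x)}[|ln(W(Y|x)/q(Y)) − C(W)|³] does not depend on x; (b) under the output distribution q, E_q[−ln α_Y] = C(W), Var_q[−ln α_Y] = V(W), and E_q[|−ln α_Y − C(W)|³] = m₃(x_o). -/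

import Mathlib

open Real Finset

variable {X Y : Type} [Fintype X] [Fintype Y]

/-- A discrete memoryless channel: `W x y` is the probability of output `y` given input `x`. -/
def IsDMC (W : X → Y → ℝ) : Prop :=
  (∀ x y, 0 ≤ W x y) ∧ ∀ x, ∑ y, W x y = 1

/-- A probability distribution on a finite alphabet. -/
def IsProbDist (Q : X → ℝ) : Prop :=
  (∀ x, 0 ≤ Q x) ∧ ∑ x, Q x = 1

/-- Gallager symmetry: the output alphabet can be partitioned into classes such that within
each class every row is a permutation of every other row, and every column is a permutation
of every other column. -/
def GallagerSymmetric (W : X → Y → ℝ) : Prop :=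
  ∃ cls : Y → ℕ,
    (∀ (l : ℕ) (x x' : X),
        ((Finset.univ.filter fun y => cls y = l).val.map fun y => W x y) =
        ((Finset.univ.filter fun y => cls y = l).val.map fun y => W x' y)) ∧
    (∀ y y' : Y, cls y = cls y' →
        (Finset.univ.val.map fun x => W x y) = (Finset.univ.val.map fun x => W x y'))

/-- Singularity: whenever two inputs both give an output positive probability,
they give it the same probability. -/
def Singular (W : X → Y → ℝ) : Prop :=
  ∀ x z y, 0 < W x y * W z y → W x y = W z y

/-- Gallager's function `E_o(ρ, Q)`. -/
noncomputable def Eo (W : X → Y → ℝ) (Q : X → ℝ) (ρ : ℝ) : ℝ :=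
  - Real.log (∑ y, (∑ x, Q x * W x y ^ (1 / (1 + ρ))) ^ (1 + ρ))

/-- Mutual information `I(Q; W)`. -/
noncomputable def mutualInfo (W : X → Y → ℝ) (Q : X → ℝ) : ℝ :=
  ∑ x, ∑ y, Q x * W x y * Real.log (W x y / ∑ z, Q z * W z y)

/-- Channel capacity `C(W)`. -/
noncomputable def capacity (W : X → Y → ℝ) : ℝ :=
  sSup {r | ∃ Q, IsProbDist Q ∧ r = mutualInfo W Q}

/-- The set of values whose supremum is the sphere-packing exponent. -/
def ESPset (W : X → Y → ℝ) (R : ℝ) : Set ℝ :=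
  {e | ∃ Q, IsProbDist Q ∧ ∃ ρ : ℝ, 0 ≤ ρ ∧ e = Eo W Q ρ - ρ * R}

/-- The sphere-packing exponent `E_SP(R) = max_Q sup_{ρ ≥ 0} (E_o(ρ,Q) - ρ R)`. -/
noncomputable def ESP (W : X → Y → ℝ) (R : ℝ) : ℝ := sSup (ESPset W R)

/-- The random coding exponent `E_r(R) = max_Q max_{0 ≤ ρ ≤ 1} (E_o(ρ,Q) - ρ R)`. -/
noncomputable def Er (W : X → Y → ℝ) (R : ℝ) : ℝ :=
  sSup {e | ∃ Q, IsProbDist Q ∧ ∃ ρ : ℝ, 0 ≤ ρ ∧ ρ ≤ 1 ∧ e = Eo W Q ρ - ρ * R}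

/-- `R_∞`: the supremum of rates at which the sphere-packing exponent is infinite
(i.e. the defining supremum is unbounded). -/
noncomputable def Rinf (W : X → Y → ℝ) : ℝ :=
  sSup {R | ¬ BddAbove (ESPset W R)}

/-- The critical rate `R_cr`: the smallest rate above which `E_r = E_SP`. -/
noncomputable def Rcr (W : X → Y → ℝ) : ℝ :=
  sInf {R | ∀ R', R ≤ R' → Er W R' = ESP W R'}

/-- Number of messages of an `(N, R)` code: `⌈e^{NR}⌉`. -/
noncomputable def Mof (N : ℕ) (R : ℝ) : ℕ := ⌈Real.exp (N * R)⌉₊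

/-- Error probability of message `m` for a (non-feedback) block code. -/
noncomputable def msgErrorProb (W : X → Y → ℝ) {N M : ℕ}
    (f : Fin M → Fin N → X) (φ : (Fin N → Y) → Fin M) (m : Fin M) : ℝ :=
  ∑ y ∈ Finset.univ.filter (fun y : Fin N → Y => φ y ≠ m), ∏ n, W (f m n) (y n)

/-- Average error probability of a (non-feedback) block code. -/
noncomputable def avgErrorProb (W : X → Y → ℝ) {N M : ℕ}
    (f : Fin M → Fin N → X) (φ : (Fin N → Y) → Fin M) : ℝ :=
  (M : ℝ)⁻¹ * ∑ m, msgErrorProb W f φ m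

/-- A feedback encoder, given as a function of the whole output word, is causal if the symbol
sent at time `n` depends only on the message and the outputs at times `< n`. -/
def Causal {N M : ℕ} (f : Fin M → (Fin N → Y) → Fin N → X) : Prop :=
  ∀ m y y' n, (∀ k, k < n → y k = y' k) → f m y n = f m y' n

/-- Average error probability of a feedback code. -/
noncomputable def avgErrorProbFb (W : X → Y → ℝ) {N M : ℕ}
    (f : Fin M → (Fin N → Y) → Fin N → X) (φ : (Fin N → Y) → Fin M) : ℝ :=
  (M : ℝ)⁻¹ * ∑ m, ∑ y ∈ Finset.univ.filter (fun y : Fin N → Y => φ y ≠ m),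
      ∏ n, W (f m y n) (y n)

/-- The (conditional information) dispersion `V(Q, W)`. -/
noncomputable def Vdisp (W : X → Y → ℝ) (Q : X → ℝ) : ℝ :=
  ∑ x, ∑ y, Q x * W x y *
    (Real.log (W x y / ∑ z, Q z * W z y) -
      ∑ b, W x b * Real.log (W x b / ∑ z, Q z * W z b)) ^ 2

/-- The `ε`-dispersion `V_ε(W)`: the minimum (for `ε < 1/2`) or maximum (for `ε ≥ 1/2`) of
`V(Q,W)` over capacity-achieving input distributions `Q`. -/
noncomputable def Veps (W : X → Y → ℝ) (ε : ℝ) : ℝ :=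
  if ε < 1 / 2 then
    sInf {v | ∃ Q, IsProbDist Q ∧ mutualInfo W Q = capacity W ∧ v = Vdisp W Q}
  else
    sSup {v | ∃ Q, IsProbDist Q ∧ mutualInfo W Q = capacity W ∧ v = Vdisp W Q}

/-- The standard Gaussian cumulative distribution function `Φ`. -/
noncomputable def stdGaussCDF (x : ℝ) : ℝ :=
  (Real.sqrt (2 * Real.pi))⁻¹ * ∫ t in Set.Iic x, Real.exp (-t ^ 2 / 2)

/-- The inverse `Φ⁻¹` of the standard Gaussian CDF. -/
noncomputable def stdGaussInvCDF (p : ℝ) : ℝ := sInf {x | p ≤ stdGaussCDF x}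

variable {X Y : Type} [Fintype X] [Fintype Y]

/-- The output distribution `q` induced by the uniform input distribution. -/
noncomputable def qUnif (W : X → Y → ℝ) (y : Y) : ℝ :=
  ∑ x, (Fintype.card X : ℝ)⁻¹ * W x y

/-- `α_y = Σ_{x : W(y|x) > 0} |X|⁻¹`. -/
noncomputable def alphaU (W : X → Y → ℝ) (y : Y) : ℝ :=
  ∑ x ∈ Finset.univ.filter (fun x => 0 < W x y), (Fintype.card X : ℝ)⁻¹

/-- The variance of `ln (W(Y|x)/q(Y))` when `Y ~ W(·|x)`. -/
noncomputable def varRow (W : X → Y → ℝ) (x : X) : ℝ :=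
  ∑ y, W x y * (Real.log (W x y / qUnif W y) -
    ∑ b, W x b * Real.log (W x b / qUnif W b)) ^ 2

/-- The third absolute moment of `ln (W(Y|x)/q(Y))` about `C(W)` when `Y ~ W(·|x)`. -/
noncomputable def m3Row (W : X → Y → ℝ) (x : X) : ℝ :=
  ∑ y, W x y * |Real.log (W x y / qUnif W y) - capacity W| ^ 3

theorem qUnif_pos {X Y : Type} [Fintype X] [Nonempty X] {W : X → Y → ℝ}
    (hW : ∀ x y, 0 ≤ W x y) (hcol : ∀ y, ∃ x, 0 < W x y) (y : Y) : 0 < qUnif W y := by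
  obtain ⟨x, hx⟩ := hcol y
  have hn : (0 : ℝ) < (Fintype.card X : ℝ)⁻¹ := by
    have : 0 < Fintype.card X := Fintype.card_pos
    positivity
  exact Finset.sum_pos' (fun z _ => mul_nonneg hn.le (hW z y)) ⟨x, mem_univ x, mul_pos hn hx⟩

/-- For a symmetric channel, any statistic of a row together with the uniform output
distribution has the same sum over outputs for every input. -/
theorem GallagerSymmetric.sum_row_eq {X Y : Type} [Fintype X] [Fintype Y] {W : X → Y → ℝ}
    (hsym : GallagerSymmetric W) (F : ℝ → ℝ → ℝ) (x x' : X) :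
    ∑ y, F (W x y) (qUnif W y) = ∑ y, F (W x' y) (qUnif W y) := by
  obtain ⟨cls, hrow, hcolumn⟩ := hsym
  have hq : ∀ y y', cls y = cls y' → qUnif W y = qUnif W y' := by
    intro y y' h
    have := congrArg Multiset.sum (hcolumn y y' h)
    unfold qUnif
    rw [← Finset.mul_sum, ← Finset.mul_sum]
    exact congrArg _ this
  have key : ∀ l ∈ Finset.univ.image cls,
      ∑ y ∈ Finset.univ.filter (fun y => cls y = l), F (W x y) (qUnif W y) =
      ∑ y ∈ Finset.univ.filter (fun y => cls y = l), F (W x' y) (qUnif W y) := by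
    intro l hl
    obtain ⟨y₀, -, rfl⟩ := Finset.mem_image.1 hl
    have hconst : ∀ z, ∑ y ∈ Finset.univ.filter (fun y => cls y = cls y₀),
        F (W z y) (qUnif W y) =
        ∑ y ∈ Finset.univ.filter (fun y => cls y = cls y₀), F (W z y) (qUnif W y₀) := by
      intro z
      refine Finset.sum_congr rfl fun y hy => ?_
      rw [hq y y₀ (Finset.mem_filter.1 hy).2]
    rw [hconst, hconst]
    have := congrArg (fun m => (Multiset.map (fun a => F a (qUnif W y₀)) m).sum)
      (hrow (cls y₀) x x')
    rwa [Multiset.map_map, Multiset.map_map] at this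
  rw [← Finset.sum_fiberwise_of_maps_to (s := Finset.univ) (t := Finset.univ.image cls) (g := cls)
      (fun y hy => Finset.mem_image_of_mem _ hy),
    ← Finset.sum_fiberwise_of_maps_to (s := Finset.univ) (t := Finset.univ.image cls) (g := cls)
      (fun y hy => Finset.mem_image_of_mem _ hy)]
  exact Finset.sum_congr rfl key

theorem sub_le_mul_log_div {p q : ℝ} (hp : 0 ≤ p) (hq : 0 < q) :
    p - q ≤ p * Real.log (p / q) := by
  rcases hp.eq_or_lt with rfl | hp
  · simpa using hq.le
  · have h := mul_le_mul_of_nonneg_left (Real.log_le_sub_one_of_pos (div_pos hq hp)) hp.le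
    rw [← inv_div p q, Real.log_inv, inv_div, mul_sub, mul_div_cancel₀ _ hp.ne'] at h
    linarith

theorem sub_lt_mul_log_div {p q : ℝ} (hp : 0 ≤ p) (hq : 0 < q) (hpq : p ≠ q) :
    p - q < p * Real.log (p / q) := by
  rcases hp.eq_or_lt with rfl | hp
  · simpa using hq
  · have hne : q / p ≠ 1 := fun h => hpq ((div_eq_one_iff_eq hp.ne').1 h).symm
    have h := mul_lt_mul_of_pos_left (Real.log_lt_sub_one_of_pos (div_pos hq hp) hne) hp
    rw [← inv_div p q, Real.log_inv, inv_div, mul_sub, mul_div_cancel₀ _ hp.ne'] at h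
    linarith

/-- Gibbs' inequality. -/
theorem sum_mul_log_div_nonneg {Y : Type} [Fintype Y] {p q : Y → ℝ} (hp : ∀ y, 0 ≤ p y)
    (hq : ∀ y, 0 < q y) (hpq : ∑ y, p y = ∑ y, q y) :
    0 ≤ ∑ y, p y * Real.log (p y / q y) := by
  have h : ∑ y, (p y - q y) ≤ ∑ y, p y * Real.log (p y / q y) :=
    Finset.sum_le_sum fun y _ => sub_le_mul_log_div (hp y) (hq y)
  rwa [Finset.sum_sub_distrib, hpq, sub_self] at h

/-- The equality case of Gibbs' inequality. -/
theorem eq_of_sum_mul_log_div_eq_zero {Y : Type} [Fintype Y] {p q : Y → ℝ} (hp : ∀ y, 0 ≤ p y)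
    (hq : ∀ y, 0 < q y) (hpq : ∑ y, p y = ∑ y, q y)
    (h0 : ∑ y, p y * Real.log (p y / q y) = 0) : p = q := by
  by_contra hne
  obtain ⟨y, hy⟩ := Function.ne_iff.1 hne
  have h : ∑ y, (p y - q y) < ∑ y, p y * Real.log (p y / q y) :=
    Finset.sum_lt_sum (fun y _ => sub_le_mul_log_div (hp y) (hq y))
      ⟨y, mem_univ y, sub_lt_mul_log_div (hp y) (hq y) hy⟩
  rw [Finset.sum_sub_distrib, hpq, sub_self, h0] at h
  exact lt_irrefl _ h

/-- Topsøe's identity: mutual information as an averaged divergence from a reference output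
distribution minus the divergence of the actual output distribution from the reference. -/
theorem mutualInfo_eq_sub {X Y : Type} [Fintype X] [Fintype Y] {W : X → Y → ℝ} {Q : X → ℝ}
    {q : Y → ℝ} (hW : ∀ x y, 0 ≤ W x y) (hQ : ∀ x, 0 ≤ Q x) (hq : ∀ y, 0 < q y) :
    mutualInfo W Q = ∑ x, Q x * ∑ y, W x y * Real.log (W x y / q y) -
      ∑ y, (∑ z, Q z * W z y) * Real.log ((∑ z, Q z * W z y) / q y) := by
  have h : ∀ x y, Q x * W x y * Real.log (W x y / ∑ z, Q z * W z y) =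
      Q x * (W x y * Real.log (W x y / q y)) -
        Q x * W x y * Real.log ((∑ z, Q z * W z y) / q y) := by
    intro x y
    by_cases hz : Q x * W x y = 0
    · rw [← mul_assoc, hz]
      simp
    · have hpos : 0 < Q x * W x y := lt_of_le_of_ne (mul_nonneg (hQ x) (hW x y)) (Ne.symm hz)
      have hs : 0 < ∑ z, Q z * W z y :=
        hpos.trans_le (Finset.single_le_sum (f := fun z => Q z * W z y)
          (fun z _ => mul_nonneg (hQ z) (hW z y)) (mem_univ x))
      have hw : W x y ≠ 0 := right_ne_zero_of_mul hz
      rw [Real.log_div hw hs.ne', Real.log_div hw (hq y).ne', Real.log_div hs.ne' (hq y).ne']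
      ring
  unfold mutualInfo
  simp only [h, Finset.sum_sub_distrib, Finset.mul_sum, Finset.sum_mul]
  congr 1
  exact Finset.sum_comm

theorem sum_output_eq_one {X Y : Type} [Fintype X] [Fintype Y] {W : X → Y → ℝ} {Q : X → ℝ}
    (hW : IsDMC W) (hQ : IsProbDist Q) : ∑ y, ∑ x, Q x * W x y = 1 := by
  rw [Finset.sum_comm]
  simp only [← Finset.mul_sum, hW.2, mul_one, hQ.2]

theorem isProbDist_uniform {X : Type} [Fintype X] [Nonempty X] :
    IsProbDist (fun _ : X => (Fintype.card X : ℝ)⁻¹) := by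
  refine ⟨fun _ => by positivity, ?_⟩
  have : (Fintype.card X : ℝ) ≠ 0 := Nat.cast_ne_zero.2 Fintype.card_ne_zero
  simp [this]

/-- If all rows have the same divergence `c` from the positive uniform output distribution, then
the capacity is `c`, it is achieved by the uniform input distribution, and every
capacity-achieving distribution induces the same output distribution. -/
theorem capacity_eq_of_forall_divergence_eq {X Y : Type} [Fintype X] [Fintype Y] [Nonempty X]
    {W : X → Y → ℝ} (hW : IsDMC W) (hq : ∀ y, 0 < qUnif W y) {c : ℝ}
    (hc : ∀ x, ∑ y, W x y * Real.log (W x y / qUnif W y) = c) :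
    capacity W = c ∧ mutualInfo W (fun _ => (Fintype.card X : ℝ)⁻¹) = c ∧
      ∀ Q, IsProbDist Q → mutualInfo W Q = c → (fun y => ∑ x, Q x * W x y) = qUnif W := by
  have hI : ∀ Q, IsProbDist Q → mutualInfo W Q =
      c - ∑ y, (∑ z, Q z * W z y) * Real.log ((∑ z, Q z * W z y) / qUnif W y) := by
    intro Q hQ
    rw [mutualInfo_eq_sub hW.1 hQ.1 hq]
    simp only [hc, ← Finset.sum_mul, hQ.2, one_mul]
  have hsum : ∀ Q, IsProbDist Q → ∑ y, ∑ x, Q x * W x y = ∑ y, qUnif W y := fun Q hQ =>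
    (sum_output_eq_one hW hQ).trans (sum_output_eq_one hW isProbDist_uniform).symm
  have hnn : ∀ Q, IsProbDist Q → ∀ y, 0 ≤ ∑ x, Q x * W x y := fun Q hQ y =>
    Finset.sum_nonneg fun x _ => mul_nonneg (hQ.1 x) (hW.1 x y)
  have hunif : mutualInfo W (fun _ => (Fintype.card X : ℝ)⁻¹) = c := by
    rw [hI _ isProbDist_uniform]
    change c - ∑ y, qUnif W y * Real.log (qUnif W y / qUnif W y) = c
    simp [fun y => div_self (hq y).ne']
  refine ⟨?_, hunif, ?_⟩
  · refine IsGreatest.csSup_eq ⟨⟨_, isProbDist_uniform, hunif.symm⟩, ?_⟩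
    rintro r ⟨Q, hQ, rfl⟩
    rw [hI Q hQ]
    exact sub_le_self _ (sum_mul_log_div_nonneg (hnn Q hQ) hq (hsum Q hQ))
  · intro Q hQ h
    rw [hI Q hQ] at h
    exact eq_of_sum_mul_log_div_eq_zero (hnn Q hQ) hq (hsum Q hQ) (by linarith)

theorem Vdisp_eq_sum_varRow {X Y : Type} [Fintype X] [Fintype Y] {W : X → Y → ℝ} {Q : X → ℝ}
    (h : (fun y => ∑ x, Q x * W x y) = qUnif W) : Vdisp W Q = ∑ x, Q x * varRow W x := by
  unfold Vdisp varRow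
  simp only [funext_iff] at h
  simp only [h, Finset.mul_sum, mul_assoc]

theorem Singular.qUnif_eq_alphaU_mul {X Y : Type} [Fintype X] {W : X → Y → ℝ}
    (hsing : Singular W) (hW : ∀ x y, 0 ≤ W x y) {x : X} {y : Y} (hxy : 0 < W x y) :
    qUnif W y = alphaU W y * W x y := by
  unfold qUnif alphaU
  rw [Finset.sum_mul, Finset.sum_filter]
  refine Finset.sum_congr rfl fun z _ => ?_
  split_ifs with hz
  · rw [hsing z x y (mul_pos hz hxy)]
  · rw [le_antisymm (not_lt.1 hz) (hW z y), mul_zero]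

theorem Singular.log_div_qUnif {X Y : Type} [Fintype X] {W : X → Y → ℝ}
    (hsing : Singular W) (hW : ∀ x y, 0 ≤ W x y) {x : X} {y : Y} (hxy : 0 < W x y) :
    Real.log (W x y / qUnif W y) = -Real.log (alphaU W y) := by
  rw [hsing.qUnif_eq_alphaU_mul hW hxy, div_mul_cancel_right₀ hxy.ne', Real.log_inv]

/-- For a symmetric singular channel, `-ln α_Y` under the uniform output distribution has the
same law as the information density under any row. -/
theorem sum_qUnif_mul_alphaU {X Y : Type} [Fintype X] [Fintype Y] [Nonempty X] {W : X → Y → ℝ}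
    (hW : IsDMC W) (hsym : GallagerSymmetric W) (hsing : Singular W) (G : ℝ → ℝ) (x : X) :
    ∑ y, qUnif W y * G (-Real.log (alphaU W y)) =
      ∑ y, W x y * G (Real.log (W x y / qUnif W y)) := by
  have h : ∀ z y, W z y * G (-Real.log (alphaU W y)) =
      W z y * G (Real.log (W z y / qUnif W y)) := by
    intro z y
    rcases (hW.1 z y).eq_or_lt with h0 | h0
    · simp [← h0]
    · rw [hsing.log_div_qUnif hW.1 h0]
  have hrow : ∀ z, ∑ y, W z y * G (Real.log (W z y / qUnif W y)) =
      ∑ y, W x y * G (Real.log (W x y / qUnif W y)) := fun z =>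
    hsym.sum_row_eq (fun a b => a * G (Real.log (a / b))) z x
  calc ∑ y, qUnif W y * G (-Real.log (alphaU W y))
      = ∑ y, ∑ z, (Fintype.card X : ℝ)⁻¹ * (W z y * G (-Real.log (alphaU W y))) := by
        refine Finset.sum_congr rfl fun y _ => ?_
        rw [qUnif, Finset.sum_mul]
        simp only [mul_assoc]
    _ = ∑ z, (Fintype.card X : ℝ)⁻¹ * ∑ y, W x y * G (Real.log (W x y / qUnif W y)) := by
        rw [Finset.sum_comm]
        exact Finset.sum_congr rfl fun z _ => by simp only [h, ← Finset.mul_sum, hrow]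
    _ = ∑ y, W x y * G (Real.log (W x y / qUnif W y)) := by
        rw [← Finset.sum_mul, isProbDist_uniform.2, one_mul]

/-- **Lemma (sym-prelim)(ii),(iv)**: for a symmetric singular channel with no all-zero columns,
the conditional mean, variance and third absolute moment of the information density do not
depend on the input; the mean is `C(W)`, the variance equals `V_ε(W)` for every `ε ∈ (0,1)`;
and under the uniform output distribution `q`, the random variable `-ln α_Y` has mean `C(W)`,
variance `V(W)` and matching third absolute moment. -/
theorem statement16 {X Y : Type} [Fintype X] [Fintype Y] [Nonempty X] [Nonempty Y]
    (W : X → Y → ℝ) (hW : IsDMC W) (hsym : GallagerSymmetric W) (hsing : Singular W)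
    (hcol : ∀ y, ∃ x, 0 < W x y) (xo : X) :
    (∀ x, ∑ y, W x y * Real.log (W x y / qUnif W y) = capacity W) ∧
      (∀ x, ∀ ε : ℝ, 0 < ε → ε < 1 → varRow W x = Veps W ε) ∧
      (∀ x, m3Row W x = m3Row W xo) ∧
      (∑ y, qUnif W y * (-Real.log (alphaU W y)) = capacity W) ∧
      (∑ y, qUnif W y * (-Real.log (alphaU W y) - capacity W) ^ 2 = varRow W xo) ∧
      (∑ y, qUnif W y * |(-Real.log (alphaU W y)) - capacity W| ^ 3 = m3Row W xo) := by
  have hq : ∀ y, 0 < qUnif W y := qUnif_pos hW.1 hcol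
  obtain ⟨hcap, hunif, huniq⟩ := capacity_eq_of_forall_divergence_eq hW hq
    (fun x => hsym.sum_row_eq (fun a b => a * Real.log (a / b)) x xo)
  have hmean : ∀ x, ∑ y, W x y * Real.log (W x y / qUnif W y) = capacity W := fun x =>
    (hsym.sum_row_eq (fun a b => a * Real.log (a / b)) x xo).trans hcap.symm
  rw [← hcap] at hunif huniq
  have hvar : ∀ x, varRow W x = varRow W xo := by
    intro x
    unfold varRow
    simp only [hmean]
    exact hsym.sum_row_eq (fun a b => a * (Real.log (a / b) - capacity W) ^ 2) x xo
  have hset : {v | ∃ Q, IsProbDist Q ∧ mutualInfo W Q = capacity W ∧ v = Vdisp W Q} =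
      {varRow W xo} := by
    have hV : ∀ Q, IsProbDist Q → mutualInfo W Q = capacity W → Vdisp W Q = varRow W xo := by
      intro Q hQ hI
      rw [Vdisp_eq_sum_varRow (huniq Q hQ hI)]
      simp only [hvar, ← Finset.sum_mul, hQ.2, one_mul]
    ext v
    constructor
    · rintro ⟨Q, hQ, hI, rfl⟩
      exact hV Q hQ hI
    · rintro rfl
      exact ⟨_, isProbDist_uniform, hunif, (hV _ isProbDist_uniform hunif).symm⟩
  refine ⟨hmean, fun x ε _ _ => ?_, fun x => ?_, ?_, ?_, ?_⟩
  · rw [hvar, Veps, hset, csInf_singleton, csSup_singleton, ite_self]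
  · exact hsym.sum_row_eq (fun a b => a * |Real.log (a / b) - capacity W| ^ 3) x xo
  · exact (sum_qUnif_mul_alphaU hW hsym hsing (fun t => t) xo).trans (hmean xo)
  · unfold varRow
    rw [hmean]
    exact sum_qUnif_mul_alphaU hW hsym hsing (fun t => (t - capacity W) ^ 2) xo
  · exact sum_qUnif_mul_alphaU hW hsym hsing (fun t => |t - capacity W| ^ 3) xo
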